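/- Let m_1,…,m_n be a minimal generating set of a generic monomial ideal I of R and let 1 ≤ i < j ≤ n. Then σ_{ij} ∈ 𝔪Z₂ if and only if there exists an index k with k ≠ i, k ≠ j such that m_{ik} strictly divides m_{ij} and m_{jk} strictly divides m_{ij}. -/

import Mathlib

open MvPolynomial

noncomputable section

/-- The trivariate polynomial ring `K[x,y,z]`, with variables indexed by `Fin 3`. -/
abbrev PR (K : Type*) [Field K] : Type _ := MvPolynomial (Fin 3) K

/-- The monomial of `K[x,y,z]` with exponent vector `a : Fin 3 → ℕ`. -/
noncomputable def monom (K : Type*) [Field K] (a : Fin 3 → ℕ) : PR K :=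
  ∏ t, X t ^ a t

/-- `m 0, …, m (n-1)` (given by their exponent vectors) form a minimal generating set of the
monomial ideal they generate: they are pairwise distinct and no one divides another.
(Divisibility of monomials is pointwise `≤` of exponent vectors, so non-divisibility for all
pairs of distinct indices already implies distinctness.) -/
def MinGen {n : ℕ} (m : Fin n → Fin 3 → ℕ) : Prop :=
  ∀ i j, i ≠ j → ¬ m i ≤ m j

/-- Strict divisibility of monomials, in terms of exponent vectors: `a` divides `b` and `a ≠ b`. -/
def strictDvd (a b : Fin 3 → ℕ) : Prop := a ≤ b ∧ a ≠ b

/-- Strong divisibility of monomials: `a` divides `b / x_t` for every variable `x_t`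
dividing `b`. -/
def strongDvd (a b : Fin 3 → ℕ) : Prop :=
  ∀ t, 0 < b t → a ≤ b - Pi.single t 1

/-- A monomial ideal (given by the exponent vectors of its minimal generators) is generic if
whenever two distinct minimal generators have the same positive exponent in some variable,
a third minimal generator strongly divides their lcm. -/
def GenericI {n : ℕ} (m : Fin n → Fin 3 → ℕ) : Prop :=
  ∀ i j, i ≠ j → (∃ t, 0 < m i t ∧ m i t = m j t) →
    ∃ l, l ≠ i ∧ l ≠ j ∧ strongDvd (m l) (m i ⊔ m j)

/-- The homogeneous maximal ideal `𝔪 = (x,y,z)` of `K[x,y,z]`. -/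
noncomputable def mxIdeal (K : Type*) [Field K] : Ideal (PR K) :=
  Ideal.span (Set.range X)

/-- The `R`-linear map `f₁ : Rⁿ → R` sending the `i`-th standard basis vector to the
monomial `m_i`. -/
noncomputable def syzF1 (K : Type*) [Field K] {n : ℕ} (m : Fin n → Fin 3 → ℕ) :
    (Fin n → PR K) →ₗ[PR K] PR K where
  toFun v := ∑ i, v i * monom K (m i)
  map_add' u v := by simp [add_mul, Finset.sum_add_distrib]
  map_smul' c v := by simp [Finset.mul_sum, mul_assoc]

/-- The module `Z₂ = ker f₁` of second syzygies of `R/I`. -/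
noncomputable def Z2 (K : Type*) [Field K] {n : ℕ} (m : Fin n → Fin 3 → ℕ) :
    Submodule (PR K) (Fin n → PR K) :=
  LinearMap.ker (syzF1 K m)

/-- The S-pair `σ_{ij} = (m_{ij}/m_j)·e_j − (m_{ij}/m_i)·e_i ∈ Rⁿ`. -/
noncomputable def sigmaS (K : Type*) [Field K] {n : ℕ} (m : Fin n → Fin 3 → ℕ)
    (i j : Fin n) : Fin n → PR K :=
  Pi.single j (monom K ((m i ⊔ m j) - m j)) - Pi.single i (monom K ((m i ⊔ m j) - m i))

/-- `τ_{ijl} = (m_{ijl}/m_{ij})·e_{ij} − (m_{ijl}/m_{il})·e_{il} + (m_{ijl}/m_{jl})·e_{jl}`,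
an element of the free module `F₂` with basis `e_{pq}` indexed by pairs. -/
noncomputable def tauS (K : Type*) [Field K] {n : ℕ} (m : Fin n → Fin 3 → ℕ)
    (i j l : Fin n) : Fin n × Fin n → PR K :=
  Pi.single (i, j) (monom K ((m i ⊔ m j ⊔ m l) - (m i ⊔ m j)))
    - Pi.single (i, l) (monom K ((m i ⊔ m j ⊔ m l) - (m i ⊔ m l)))
    + Pi.single (j, l) (monom K ((m i ⊔ m j ⊔ m l) - (m j ⊔ m l)))

/-- The submodule `Z₃` of `F₂` generated by all `τ_{abc}` with `a < b < c`. -/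
noncomputable def Z3 (K : Type*) [Field K] {n : ℕ} (m : Fin n → Fin 3 → ℕ) :
    Submodule (PR K) (Fin n × Fin n → PR K) :=
  Submodule.span (PR K) {v | ∃ a b c : Fin n, a < b ∧ b < c ∧ v = tauS K m a b c}

theorem monom_add (K : Type*) [Field K] (a b : Fin 3 → ℕ) :
    monom K (a + b) = monom K a * monom K b := by
  simp [monom, pow_add, Finset.prod_mul_distrib]

theorem monom_eq_monomial (K : Type*) [Field K] (a : Fin 3 → ℕ) :
    monom K a = monomial (Finsupp.equivFunOnFinite.symm a) 1 := by
  rw [MvPolynomial.monomial_eq, Finsupp.prod_fintype _ _ (by simp)]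
  simp [monom]

theorem monom_mem_mxIdeal (K : Type*) [Field K] {a : Fin 3 → ℕ} (ha : a ≠ 0) :
    monom K a ∈ mxIdeal K := by
  obtain ⟨t, ht⟩ := Function.ne_iff.mp ha
  have hX : (X t : PR K) ∈ mxIdeal K := Ideal.subset_span ⟨t, rfl⟩
  exact Ideal.mem_of_dvd _
    ((dvd_pow_self _ ht).trans (Finset.dvd_prod_of_mem _ (Finset.mem_univ t))) hX

theorem coeff_zero_of_mem_mxIdeal {K : Type*} [Field K] {r : PR K} (hr : r ∈ mxIdeal K) :
    coeff 0 r = 0 := by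
  have h : mxIdeal K ≤ RingHom.ker (constantCoeff : PR K →+* K) := by
    rw [mxIdeal, Ideal.span_le]
    rintro _ ⟨t, rfl⟩
    simp [RingHom.mem_ker]
  simpa [RingHom.mem_ker, constantCoeff_eq] using h hr

theorem sigmaS_mem_Z2 (K : Type*) [Field K] {n : ℕ} (m : Fin n → Fin 3 → ℕ) (i j : Fin n) :
    sigmaS K m i j ∈ Z2 K m := by
  have hsingle : ∀ (l : Fin n) (p : PR K), syzF1 K m (Pi.single l p) = p * monom K (m l) := by
    intro l p
    simp [syzF1, Pi.single_apply, ite_mul]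
  rw [Z2, LinearMap.mem_ker, sigmaS, map_sub, hsingle, hsingle, ← monom_add, ← monom_add,
    tsub_add_cancel_of_le le_sup_right, tsub_add_cancel_of_le le_sup_left, sub_self]

theorem sigmaS_eq_of_le (K : Type*) [Field K] {n : ℕ} (m : Fin n → Fin 3 → ℕ) {i j l : Fin n}
    (hl : m l ≤ m i ⊔ m j) :
    sigmaS K m i j = monom K (m i ⊔ m j - m i ⊔ m l) • sigmaS K m i l
      + monom K (m i ⊔ m j - m l ⊔ m j) • sigmaS K m l j := by
  have key : ∀ {a b c : Fin 3 → ℕ}, a ≤ b → b ≤ c →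
      monom K (c - b) * monom K (b - a) = monom K (c - a) := by
    intro a b c hab hbc
    rw [← monom_add, tsub_add_tsub_cancel hbc hab]
  have hil : m i ⊔ m l ≤ m i ⊔ m j := sup_le le_sup_left hl
  have hlj : m l ⊔ m j ≤ m i ⊔ m j := sup_le hl le_sup_right
  simp only [sigmaS, smul_sub, ← Pi.single_smul', smul_eq_mul, key le_sup_left hil,
    key le_sup_right hil, key le_sup_left hlj, key le_sup_right hlj]
  abel

/-- If no generator other than `m i` divides the monomial of exponent `m i + c`, then the monomial
of exponent `c` does not occur in the `i`-th component of a syzygy. -/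
theorem coeff_eq_zero_of_mem_Z2 {K : Type*} [Field K] {n : ℕ} {m : Fin n → Fin 3 → ℕ}
    {i : Fin n} {c : Fin 3 →₀ ℕ} (hc : ∀ l, l ≠ i → ¬ m l ≤ m i + c) {v : Fin n → PR K}
    (hv : v ∈ Z2 K m) : coeff c (v i) = 0 := by
  classical
  have h : ∑ l, v l * monom K (m l) = 0 := hv
  have h' := congrArg (coeff (c + Finsupp.equivFunOnFinite.symm (m i))) h
  rw [coeff_sum, coeff_zero, Finset.sum_eq_single i] at h'
  · simpa [monom_eq_monomial] using h'
  · intro l _ hl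
    rw [monom_eq_monomial, coeff_mul_monomial', if_neg]
    intro hle
    refine hc l hl fun t => ?_
    simpa [add_comm] using hle t
  · simp

theorem coeff_eq_zero_of_mem_mxIdeal_smul_Z2 {K : Type*} [Field K] {n : ℕ}
    {m : Fin n → Fin 3 → ℕ} {i : Fin n} {c : Fin 3 →₀ ℕ}
    (hc : ∀ l, l ≠ i → ∀ a < c, ¬ m l ≤ m i + a) {v : Fin n → PR K}
    (hv : v ∈ mxIdeal K • Z2 K m) : coeff c (v i) = 0 := by
  classical
  refine Submodule.smul_induction_on (p := fun w => coeff c (w i) = 0) hv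
    (fun r hr w hw => ?_) fun x y hx hy => by simp [hx, hy]
  rw [Pi.smul_apply, smul_eq_mul, coeff_mul]
  refine Finset.sum_eq_zero fun p hp => ?_
  rw [Finset.HasAntidiagonal.mem_antidiagonal] at hp
  by_cases h0 : p.1 = 0
  · rw [h0, coeff_zero_of_mem_mxIdeal hr, zero_mul]
  · have hlt : p.2 < c := by
      rw [← hp]
      exact lt_add_of_pos_left _ (pos_iff_ne_zero.mpr h0)
    rw [coeff_eq_zero_of_mem_Z2 (fun l hl => hc l hl _ hlt) hw, mul_zero]

theorem exists_sup_lt_of_sigmaS_mem {K : Type*} [Field K] {n : ℕ} {m : Fin n → Fin 3 → ℕ}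
    {i j : Fin n} (hij : i ≠ j) (h : sigmaS K m i j ∈ mxIdeal K • Z2 K m) :
    ∃ l, l ≠ i ∧ m i ⊔ m l < m i ⊔ m j := by
  by_contra! hno
  have h0 := coeff_eq_zero_of_mem_mxIdeal_smul_Z2
    (c := Finsupp.equivFunOnFinite.symm (m i ⊔ m j - m i)) (i := i) (fun l hl a ha hle => ?_) h
  · simp [sigmaS, hij, monom_eq_monomial] at h0
  · refine hno l hl (lt_of_le_of_lt (sup_le le_self_add hle) ?_)
    have ha' : (a : Fin 3 → ℕ) < m i ⊔ m j - m i := ha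
    calc m i + a < m i + (m i ⊔ m j - m i) := by gcongr
      _ = m i ⊔ m j := add_tsub_cancel_of_le le_sup_left

theorem strongDvd.lt {a b : Fin 3 → ℕ} (h : strongDvd a b) {t : Fin 3} (ht : 0 < b t) :
    a t < b t := by
  have := h t ht t
  simp at this
  omega

theorem strongDvd.le {a b : Fin 3 → ℕ} (h : strongDvd a b) {t : Fin 3} (ht : 0 < b t) :
    a ≤ b :=
  (h t ht).trans tsub_le_self

theorem exists_strictDvd_of_sup_lt {n : ℕ} {m : Fin n → Fin 3 → ℕ} (hm : MinGen m)
    (hgen : GenericI m) {i j l : Fin n} (hij : i ≠ j) (hli : l ≠ i)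
    (hl : m i ⊔ m l < m i ⊔ m j) :
    ∃ k, k ≠ i ∧ k ≠ j ∧ strictDvd (m i ⊔ m k) (m i ⊔ m j) ∧
      strictDvd (m j ⊔ m k) (m i ⊔ m j) := by
  have hlb : m l ≤ m i ⊔ m j := le_sup_right.trans hl.le
  by_cases hjl : m j ⊔ m l = m i ⊔ m j
  · obtain ⟨s, hs⟩ := (Pi.lt_def.mp hl).2
    obtain ⟨t, ht⟩ : ∃ t, m j t < m i t := by
      simpa [Pi.le_def] using hm i j hij
    have hlt : m i t = m l t := by
      have := congrFun hjl t
      simp only [Pi.sup_apply] at this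
      omega
    obtain ⟨k, hki, -, hk⟩ := hgen i l hli.symm ⟨t, by omega, hlt⟩
    have hpos : 0 < (m i ⊔ m l) t := by
      simp only [Pi.sup_apply]
      omega
    have hkt := hk.lt hpos
    have hkle := hk.le hpos
    have hks := hkle s
    simp only [Pi.sup_apply] at hs hkt hks
    refine ⟨k, hki, ?_, ⟨sup_le le_sup_left (hkle.trans hl.le), fun h => ?_⟩,
      ⟨sup_le le_sup_right (hkle.trans hl.le), fun h => ?_⟩⟩
    · rintro rfl
      omega
    · have := congrFun h s
      simp only [Pi.sup_apply] at this
      omega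
    · have := congrFun h t
      simp only [Pi.sup_apply] at this
      omega
  · exact ⟨l, hli, fun h => hl.ne (h ▸ rfl), ⟨hl.le, hl.ne⟩, ⟨sup_le le_sup_right hlb, hjl⟩⟩

/-- For a generic monomial ideal, `σ_{ij} ∈ 𝔪Z₂` iff there is an index
`l ≠ i, j` with `m_{il}` and `m_{jl}` both strictly dividing `m_{ij}`. -/
theorem stmt10 (K : Type*) [Field K] {n : ℕ} (m : Fin n → Fin 3 → ℕ) (hm : MinGen m)
    (hgen : GenericI m) (i j : Fin n) (hij : i < j) :
    sigmaS K m i j ∈ mxIdeal K • Z2 K m ↔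
      ∃ l, l ≠ i ∧ l ≠ j ∧ strictDvd (m i ⊔ m l) (m i ⊔ m j) ∧
        strictDvd (m j ⊔ m l) (m i ⊔ m j) := by
  constructor
  · intro h
    obtain ⟨l, hli, hl⟩ := exists_sup_lt_of_sigmaS_mem hij.ne h
    exact exists_strictDvd_of_sup_lt hm hgen hij.ne hli hl
  · rintro ⟨l, -, -, hil, hjl⟩
    have hsub : ∀ {a b : Fin 3 → ℕ}, strictDvd a b → b - a ≠ 0 := fun hab h0 =>
      hab.2 (le_antisymm hab.1 (tsub_eq_zero_iff_le.mp h0))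
    rw [sup_comm (m j)] at hjl
    rw [sigmaS_eq_of_le K m (le_sup_right.trans hil.1)]
    exact add_mem
      (Submodule.smul_mem_smul (monom_mem_mxIdeal K (hsub hil)) (sigmaS_mem_Z2 K m i l))
      (Submodule.smul_mem_smul (monom_mem_mxIdeal K (hsub hjl)) (sigmaS_mem_Z2 K m l j))
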